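/- Let the target set S be c-dense and let F** = (S, R**, M**) be the FVR defined by Procedure E2. Then F** is universal in P_k, and for every P ∈ P_k its expected output length satisfies L_P^n(M*) − c·h(1/c) ≤ L_P^n(M**) ≤ L_P^n(M*), where L_P^n(M*) = E_P[ log |T(X^n)| ] is the expected output length of the unconstrained-target optimum and h is the binary entropy function. -/

import Mathlib

open Finset

/-- Symbol at (0-indexed) integer position `j` of `x : Fin n → A`, where negative
positions `-k, …, -1` are given by the fixed initial state `s0`. -/
def symAt {A : Type*} [Inhabited A] (k n : ℕ) (s0 : Fin k → A) (x : Fin n → A) (j : ℤ) : A :=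
  if h : 0 ≤ j then
    (if h2 : j.toNat < n then x ⟨j.toNat, h2⟩ else default)
  else
    (if h3 : (j + k).toNat < k then s0 ⟨(j + k).toNat, h3⟩ else default)

/-- The state (context of order `k`) preceding position `t` of `x`. -/
def ctx {A : Type*} [Inhabited A] (k n : ℕ) (s0 : Fin k → A) (x : Fin n → A)
    (t : Fin n) : Fin k → A :=
  fun i => symAt k n s0 x ((t : ℤ) - (k : ℤ) + (i : ℤ))

/-- Probability `P(x^n) = ∏_t p(x_t | x_{t-k}^{t-1})` of the sequence `x`. -/
def seqProb {A : Type*} [Inhabited A] (k n : ℕ) (s0 : Fin k → A)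
    (p : (Fin k → A) → A → ℝ) (x : Fin n → A) : ℝ :=
  ∏ t : Fin n, p (ctx k n s0 x t) (x t)

/-- `p` is a (strictly positive) `k`-th order Markov kernel. -/
def IsMarkov {A : Type*} [Fintype A] (k : ℕ) (p : (Fin k → A) → A → ℝ) : Prop :=
  (∀ s a, 0 < p s a) ∧ ∀ s, ∑ a : A, p s a = 1

/-- `n_{sa}(x)`: number of occurrences of symbol `a` in state `s`. -/
def transCount {A : Type*} [Inhabited A] [DecidableEq A] (k n : ℕ) (s0 : Fin k → A)
    (s : Fin k → A) (a : A) (x : Fin n → A) : ℕ :=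
  (Finset.univ.filter (fun t : Fin n => ctx k n s0 x t = s ∧ x t = a)).card

/-- The type class of `x` with respect to the class of `k`-th order processes. -/
def typeClass {A : Type*} [Fintype A] [Inhabited A] [DecidableEq A] (k n : ℕ)
    (s0 : Fin k → A) (x : Fin n → A) : Finset (Fin n → A) :=
  Finset.univ.filter (fun y => ∀ s a, transCount k n s0 s a y = transCount k n s0 s a x)

/-- The FVR `(S, Rf, Mf)` is perfect for the process `p`: conditioned on
`Mf(X^n) = M0` (whenever this event has positive probability), the output
`Rf(X^n)` is uniformly distributed on `{0, …, M0 - 1}`. -/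
def PerfectFVR {A : Type*} [Fintype A] [Inhabited A] [DecidableEq A] (k n : ℕ)
    (s0 : Fin k → A) (p : (Fin k → A) → A → ℝ) (S : Set ℕ)
    (Mf Rf : (Fin n → A) → ℕ) : Prop :=
  ∀ M0 ∈ S,
    (0 < ∑ x ∈ Finset.univ.filter (fun x : Fin n → A => Mf x = M0), seqProb k n s0 p x) →
    ∀ r < M0,
      (∑ x ∈ Finset.univ.filter (fun x : Fin n → A => Mf x = M0 ∧ Rf x = r),
          seqProb k n s0 p x)
        = (∑ x ∈ Finset.univ.filter (fun x : Fin n → A => Mf x = M0),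
            seqProb k n s0 p x) / (M0 : ℝ)


/-- `g(M) = max { j ∈ S : j ≤ M }` (and `0` if no element of `S` is `≤ M`). -/
noncomputable def gmax (S : Set ℕ) (M : ℕ) : ℕ :=
  @Nat.findGreatest (· ∈ S) (Classical.decPred _) M

/-- The greedy decomposition step of Procedure E2: given the remaining class size `r`
and the index `idx` of the sequence within the remaining part of the class, return
the pair (size of the block containing the sequence, offset within that block). -/
noncomputable def e2 (S : Set ℕ) : ℕ → ℕ → ℕ × ℕ
  | r, idx =>
    if h : 0 < gmax S r ∧ gmax S r ≤ idx then e2 S (r - gmax S r) (idx - gmax S r)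
    else (gmax S r, idx)
  termination_by r idx => idx
  decreasing_by exact Nat.sub_lt (Nat.lt_of_lt_of_le h.1 h.2) h.1

/-- Binary entropy function (base-2 logarithms). -/
noncomputable def binEnt (x : ℝ) : ℝ :=
  -(x * Real.logb 2 x + (1 - x) * Real.logb 2 (1 - x))

lemma gmax_le (S : Set ℕ) (N : ℕ) : gmax S N ≤ N :=
  @Nat.findGreatest_le _ (Classical.decPred _) N

lemma gmax_pos {S : Set ℕ} (hS1 : 1 ∈ S) {N : ℕ} (hN : 0 < N) : 0 < gmax S N :=
  @Nat.le_findGreatest _ _ (Classical.decPred _) N hN hS1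

lemma e2_of_lt {S : Set ℕ} {N i : ℕ} (h : i < gmax S N) : e2 S N i = (gmax S N, i) := by
  rw [e2, dif_neg (by omega)]

lemma e2_gmax_add {S : Set ℕ} {N : ℕ} (h : 0 < gmax S N) (i : ℕ) :
    e2 S N (gmax S N + i) = e2 S (N - gmax S N) i := by
  rw [e2, dif_pos ⟨h, by omega⟩, Nat.add_sub_cancel_left]

lemma e2_fst_le (S : Set ℕ) (N i : ℕ) : (e2 S N i).1 ≤ N := by
  induction i using Nat.strong_induction_on generalizing N with
  | _ i ih =>
    rw [e2]
    split_ifs with h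
    · exact (ih _ (by omega) _).trans (Nat.sub_le _ _)
    · exact gmax_le S N

/-- Summation over a class of size `N`, split into the first greedy block and the rest. -/
lemma sum_e2_eq {S : Set ℕ} (hS1 : 1 ∈ S) (f : ℕ × ℕ → ℝ) {N : ℕ} (hN : 0 < N) :
    ∑ i ∈ range N, f (e2 S N i) = ∑ i ∈ range (gmax S N), f (gmax S N, i) +
      ∑ i ∈ range (N - gmax S N), f (e2 S (N - gmax S N) i) := by
  conv_lhs => rw [← Nat.add_sub_cancel' (gmax_le S N), sum_range_add]
  rw [Nat.add_sub_cancel' (gmax_le S N)]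
  congr 1
  · exact sum_congr rfl fun i hi => by rw [e2_of_lt (mem_range.1 hi)]
  · exact sum_congr rfl fun i _ => by rw [e2_gmax_add (gmax_pos hS1 hN)]

/-- Every block size is hit equally often with each admissible offset. -/
lemma sum_e2_offset {S : Set ℕ} (hS1 : 1 ∈ S) {m r : ℕ} (hr : r < m) (N : ℕ) :
    ∑ i ∈ range N, (if (e2 S N i).1 = m ∧ (e2 S N i).2 = r then (1 : ℝ) else 0) =
      ∑ i ∈ range N, (if (e2 S N i).1 = m then (1 : ℝ) else 0) / m := by
  induction N using Nat.strong_induction_on with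
  | _ N ih =>
    rcases Nat.eq_zero_or_pos N with rfl | hN
    · simp
    · have hg := gmax_pos hS1 hN
      rw [sum_e2_eq hS1 (fun q => if q.1 = m ∧ q.2 = r then (1 : ℝ) else 0) hN,
        sum_e2_eq hS1 (fun q => (if q.1 = m then (1 : ℝ) else 0) / m) hN,
        ih _ (by omega)]
      congr 1
      have hm : (m : ℝ) ≠ 0 := by
        have : m ≠ 0 := by omega
        exact_mod_cast this
      by_cases h : gmax S N = m
      · simp [h, hr, hm]
      · simp [h]

lemma binEnt_eq (x : ℝ) : binEnt x = Real.binEntropy x / Real.log 2 := by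
  simp only [binEnt, Real.binEntropy, Real.logb, Real.log_inv]
  ring

/-- The ratio of the binary entropy to its argument is decreasing. -/
lemma binEnt_le_of_one_div_le {c q : ℝ} (hc : 1 ≤ c) (hq : q ≤ 1) (h : 1 / c ≤ q) :
    binEnt q ≤ c * binEnt (1 / c) * q := by
  have hc0 : 0 < c := by linarith
  have hu : 0 < 1 / c := by positivity
  have hq0 : 0 < q := hu.trans_le h
  have hq_mem : q ∈ Set.Icc (0 : ℝ) 1 := ⟨hq0.le, hq⟩
  have h0_mem : (0 : ℝ) ∈ Set.Icc (0 : ℝ) 1 := ⟨le_rfl, zero_le_one⟩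
  have hw : 0 ≤ 1 / c / q := by positivity
  have key := Real.strictConcave_binEntropy.concaveOn.2 hq_mem h0_mem hw
    (sub_nonneg.2 ((div_le_one hq0).2 h)) (add_sub_cancel _ _)
  simp only [smul_eq_mul, Real.binEntropy_zero, mul_zero, add_zero,
    div_mul_cancel₀ _ hq0.ne'] at key
  have h2 : Real.binEntropy q ≤ c * Real.binEntropy (1 / c) * q := by
    calc Real.binEntropy q = c * (1 / c / q * Real.binEntropy q) * q := by field_simp
      _ ≤ _ := by gcongr
  rw [binEnt_eq, binEnt_eq]
  calc _ ≤ (c * Real.binEntropy (1 / c) * q) / Real.log 2 :=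
        div_le_div_of_nonneg_right h2 (Real.log_pos one_lt_two).le
    _ = _ := by ring

lemma mul_logb_split {a b : ℝ} (ha : 0 < a) (hb : 0 ≤ b) :
    (a + b) * Real.logb 2 (a + b) =
      a * Real.logb 2 a + b * Real.logb 2 b + (a + b) * binEnt (a / (a + b)) := by
  have hab : a + b ≠ 0 := by positivity
  have h1 : 1 - a / (a + b) = b / (a + b) := by field_simp; ring
  rw [binEnt, h1, Real.logb_div ha.ne' hab]
  rcases hb.eq_or_lt with rfl | hb
  · simp [ha.ne']
  · rw [Real.logb_div hb.ne' hab]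
    field_simp
    ring

lemma mul_logb_le_sum_e2 {S : Set ℕ} (hS1 : 1 ∈ S) {c : ℝ} (hc : 1 ≤ c)
    (hdense : ∀ M : ℕ, 0 < M → (M : ℝ) ≤ c * (gmax S M : ℝ)) (N : ℕ) :
    N * Real.logb 2 N ≤
      ∑ i ∈ range N, Real.logb 2 (e2 S N i).1 + N * (c * binEnt (1 / c)) := by
  induction N using Nat.strong_induction_on with
  | _ N ih =>
    rcases Nat.eq_zero_or_pos N with rfl | hN
    · simp
    · have hg := gmax_pos hS1 hN
      have hle := gmax_le S N
      rw [sum_e2_eq hS1 (fun q => Real.logb 2 q.1) hN]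
      have ih' := ih (N - gmax S N) (by omega)
      have hd := hdense N hN
      set g := gmax S N
      clear_value g
      obtain ⟨r, rfl⟩ := Nat.exists_eq_add_of_le hle
      rw [Nat.add_sub_cancel_left] at ih' ⊢
      have hg' : (0 : ℝ) < g := by exact_mod_cast hg
      have hr : (0 : ℝ) ≤ r := by positivity
      have hgr : (0 : ℝ) < g + r := by positivity
      push_cast at hd ⊢
      rw [mul_logb_split hg' hr]
      have hb := binEnt_le_of_one_div_le hc (q := g / (g + r))
        ((div_le_one hgr).2 (by linarith))
        (by rw [div_le_div_iff₀ (by linarith) hgr]; linarith)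
      have hb' : (g + r) * binEnt (g / (g + r)) ≤ g * (c * binEnt (1 / c)) := by
        calc _ ≤ ((g : ℝ) + r) * (c * binEnt (1 / c) * (g / (g + r))) := by gcongr
          _ = _ := by field_simp
      simp only [sum_const, card_range, nsmul_eq_mul]
      linarith

section MarkovSource

variable {A : Type*} [Inhabited A] {k n : ℕ} {s0 : Fin k → A}

lemma symAt_snoc (x : Fin n → A) (a : A) {j : ℤ} (hj : j < n) :
    symAt k (n + 1) s0 (Fin.snoc x a) j = symAt k n s0 x j := by
  unfold symAt
  split_ifs with h1 h2 h3 <;> first | rfl | omega | skip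
  exact Fin.snoc_castSucc (α := fun _ => A) a x ⟨j.toNat, h3⟩

lemma seqProb_snoc (p : (Fin k → A) → A → ℝ) (x : Fin n → A) (a : A) :
    seqProb k (n + 1) s0 p (Fin.snoc x a) =
      seqProb k n s0 p x * p (fun i => symAt k n s0 x ((n : ℤ) - k + i)) a := by
  have hctx : ∀ t : Fin (n + 1), ctx k (n + 1) s0 (Fin.snoc x a) t =
      fun i : Fin k => symAt k n s0 x ((t : ℤ) - k + i) := fun t =>
    funext fun i => symAt_snoc x a (by have := t.2; have := i.2; omega)
  simp only [seqProb, Fin.prod_univ_castSucc, hctx, Fin.snoc_last, Fin.snoc_castSucc,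
    Fin.val_last, Fin.val_castSucc]
  rfl

variable [Fintype A]

lemma seqProb_nonneg {p : (Fin k → A) → A → ℝ} (hp : IsMarkov k p) (x : Fin n → A) :
    0 ≤ seqProb k n s0 p x :=
  prod_nonneg fun _ _ => (hp.1 _ _).le

lemma sum_seqProb {p : (Fin k → A) → A → ℝ} (hp : IsMarkov k p) :
    ∑ x : Fin n → A, seqProb k n s0 p x = 1 := by
  induction n with
  | zero => simp [seqProb]
  | succ n ih =>
    rw [← (Fin.snocEquiv fun _ => A).sum_comp, Fintype.sum_prod_type_right, ← ih]
    refine sum_congr rfl fun x _ => ?_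
    calc _ = ∑ a : A, seqProb k n s0 p x *
          p (fun i => symAt k n s0 x ((n : ℤ) - k + i)) a :=
          sum_congr rfl fun a _ => seqProb_snoc p x a
      _ = _ := by rw [← mul_sum, hp.2, mul_one]

variable [DecidableEq A]

lemma seqProb_eq_prod_pow (p : (Fin k → A) → A → ℝ) (x : Fin n → A) :
    seqProb k n s0 p x = ∏ q : (Fin k → A) × A, p q.1 q.2 ^ transCount k n s0 q.1 q.2 x := by
  rw [seqProb, ← prod_fiberwise univ fun t => (ctx k n s0 x t, x t)]
  refine prod_congr rfl fun q _ => ?_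
  rw [transCount, ← prod_const]
  refine prod_congr (by ext t; simp [Prod.ext_iff]) fun t ht => ?_
  obtain ⟨h1, h2⟩ := (mem_filter.1 ht).2
  rw [h1, h2]

lemma seqProb_eq_of_mem_typeClass (p : (Fin k → A) → A → ℝ) {x y : Fin n → A}
    (h : y ∈ typeClass k n s0 x) : seqProb k n s0 p y = seqProb k n s0 p x := by
  have h' := (mem_filter.1 h).2
  simp only [seqProb_eq_prod_pow, h']

lemma self_mem_typeClass (x : Fin n → A) : x ∈ typeClass k n s0 x := by
  simp [typeClass]

lemma typeClass_eq_iff {x y : Fin n → A} :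
    typeClass k n s0 y = typeClass k n s0 x ↔ y ∈ typeClass k n s0 x := by
  refine ⟨fun h => h ▸ self_mem_typeClass y, fun h => ?_⟩
  have h' := (mem_filter.1 h).2
  simp only [typeClass, h']

/-- An inequality for averages over the indices of a class of each size carries over to
expectations with respect to any Markov process. -/
lemma sum_seqProb_mul_le {enum : (Fin n → A) → ℕ}
    (henum1 : ∀ x, enum x < (typeClass k n s0 x).card)
    (henum2 : ∀ x y, y ∈ typeClass k n s0 x → enum y = enum x → y = x)
    {p : (Fin k → A) → A → ℝ} (hp : IsMarkov k p) {F G : ℕ → ℕ → ℝ}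
    (hFG : ∀ N, ∑ i ∈ range N, F N i ≤ ∑ i ∈ range N, G N i) :
    ∑ x, seqProb k n s0 p x * F (typeClass k n s0 x).card (enum x) ≤
      ∑ x, seqProb k n s0 p x * G (typeClass k n s0 x).card (enum x) := by
  have hinj : ∀ x, Set.InjOn enum (typeClass k n s0 x : Set (Fin n → A)) := by
    intro x y hy z hz hyz
    exact henum2 z y (typeClass_eq_iff.1 ((typeClass_eq_iff.2 hy).trans
      (typeClass_eq_iff.2 hz).symm)) hyz
  have himage : ∀ x, (typeClass k n s0 x).image enum = range (typeClass k n s0 x).card := by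
    intro x
    refine eq_of_subset_of_card_le (fun i hi => ?_) ?_
    · obtain ⟨y, hy, rfl⟩ := mem_image.1 hi
      exact mem_range.2 (typeClass_eq_iff.2 hy ▸ henum1 y)
    · rw [card_range, card_image_of_injOn (hinj x)]
  have hclass : ∀ (H : ℕ → ℕ → ℝ) (x : Fin n → A),
      ∑ y ∈ univ.filter (fun y => typeClass k n s0 y = typeClass k n s0 x),
        seqProb k n s0 p y * H (typeClass k n s0 y).card (enum y) =
      seqProb k n s0 p x * ∑ i ∈ range (typeClass k n s0 x).card,
        H (typeClass k n s0 x).card i := by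
    intro H x
    rw [← himage x, sum_image (hinj x), mul_sum]
    refine sum_congr (by ext y; simp [typeClass_eq_iff]) fun y hy => ?_
    rw [typeClass_eq_iff.2 hy, seqProb_eq_of_mem_typeClass p hy]
  have hmaps : ∀ x ∈ (univ : Finset (Fin n → A)),
      typeClass k n s0 x ∈ univ.image (typeClass k n s0) :=
    fun x _ => mem_image_of_mem _ (mem_univ x)
  rw [← sum_fiberwise_of_maps_to hmaps, ← sum_fiberwise_of_maps_to hmaps]
  refine sum_le_sum fun T hT => ?_
  obtain ⟨x, -, rfl⟩ := mem_image.1 hT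
  rw [hclass, hclass]
  exact mul_le_mul_of_nonneg_left (hFG _) (seqProb_nonneg hp x)

end MarkovSource

/-- For a `c`-dense target set `S`, the generalized Elias FVR `F**`
of Procedure E2 is universal in `P_k` and its expected output length is within
`c·h(1/c)` of the optimum `L_P^n(M*) = E_P[log |T(X^n)|]`. Here `enum` is a fixed
enumeration of each type class, and `M**`, `R**` are read off the greedy
decomposition of the type class size. -/
theorem elias_e2_universal_and_near_optimal {A : Type*} [Fintype A] [DecidableEq A]
    [Inhabited A] (hA : 2 ≤ Fintype.card A) (k n : ℕ) (s0 : Fin k → A)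
    (S : Set ℕ) (hSpos : ∀ m ∈ S, 0 < m) (hS1 : 1 ∈ S)
    (c : ℝ) (hc : 1 ≤ c)
    (hdense : ∀ M : ℕ, 0 < M → (M : ℝ) ≤ c * (gmax S M : ℝ))
    (enum : (Fin n → A) → ℕ)
    (henum1 : ∀ x, enum x < (typeClass k n s0 x).card)
    (henum2 : ∀ x y, y ∈ typeClass k n s0 x → enum y = enum x → y = x) :
    (∀ p : (Fin k → A) → A → ℝ, IsMarkov k p →
      PerfectFVR k n s0 p S
        (fun x => (e2 S ((typeClass k n s0 x).card) (enum x)).1)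
        (fun x => (e2 S ((typeClass k n s0 x).card) (enum x)).2)) ∧
    (∀ p : (Fin k → A) → A → ℝ, IsMarkov k p →
      ((∑ x : Fin n → A,
          seqProb k n s0 p x * Real.logb 2 ((typeClass k n s0 x).card)) - c * binEnt (1 / c)
        ≤ ∑ x : Fin n → A,
            seqProb k n s0 p x *
              Real.logb 2 ((e2 S ((typeClass k n s0 x).card) (enum x)).1)) ∧
      (∑ x : Fin n → A,
          seqProb k n s0 p x *
            Real.logb 2 ((e2 S ((typeClass k n s0 x).card) (enum x)).1)
        ≤ ∑ x : Fin n → A,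
            seqProb k n s0 p x * Real.logb 2 ((typeClass k n s0 x).card))) := by
  refine ⟨fun p hp M0 _ _ r hr => ?_, fun p hp => ⟨?_, ?_⟩⟩
  · rw [sum_filter, sum_filter, sum_div]
    have key : ∀ N, ∑ i ∈ range N,
        (if (e2 S N i).1 = M0 ∧ (e2 S N i).2 = r then (1 : ℝ) else 0) =
        ∑ i ∈ range N, (if (e2 S N i).1 = M0 then (1 : ℝ) else 0) / M0 :=
      sum_e2_offset hS1 hr
    have h := le_antisymm
      (sum_seqProb_mul_le henum1 henum2 hp fun N => (key N).le)
      (sum_seqProb_mul_le henum1 henum2 hp fun N => (key N).ge)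
    simpa only [mul_ite, mul_one, mul_zero, mul_div_assoc'] using h
  · have h := sum_seqProb_mul_le henum1 henum2 hp
      (F := fun N _ => Real.logb 2 N)
      (G := fun N i => Real.logb 2 (e2 S N i).1 + c * binEnt (1 / c)) fun N => by
        simpa [sum_add_distrib] using mul_logb_le_sum_e2 hS1 hc hdense N
    simp only [mul_add, sum_add_distrib, ← sum_mul, sum_seqProb hp, one_mul] at h
    linarith
  · refine sum_le_sum fun x _ => mul_le_mul_of_nonneg_left ?_ (seqProb_nonneg hp x)
    have hle := e2_fst_le S (typeClass k n s0 x).card (enum x)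
    rcases Nat.eq_zero_or_pos (e2 S (typeClass k n s0 x).card (enum x)).1 with h0 | h0
    · rw [h0, Nat.cast_zero, Real.logb_zero]
      exact div_nonneg (Real.log_natCast_nonneg _) (Real.log_pos one_lt_two).le
    · exact Real.logb_le_logb_of_le one_lt_two (by exact_mod_cast h0) (by exact_mod_cast hle)
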